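/- Let K be any real n × n matrix. Then the limit L = lim_{t→∞} (1/(2t))·log(exp(tK)·exp(tK)ᵀ) exists, where log denotes the unique real symmetric matrix whose matrix exponential equals the given positive definite matrix exp(tK)·exp(tK)ᵀ. Moreover, the eigenvalues of the symmetric matrix L, counted with multiplicity, are the real parts of the eigenvalues of K, counted with multiplicity. -/

import Mathlib

open Matrix

set_option linter.unusedSectionVars false

section Abstract

variable {A : Type*} [CStarAlgebra A] [PartialOrder A] [StarOrderedRing A]

lemma aux_le_of_exp_le {X Y : A} (hX : IsSelfAdjoint X) (hY : IsSelfAdjoint Y) {c : ℝ}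
    (hc : 0 < c) (h : NormedSpace.exp X ≤ c • NormedSpace.exp Y) :
    X ≤ Y + algebraMap ℝ A (Real.log c) := by
  let _ : NormedAlgebra ℚ A := NormedAlgebra.restrictScalars ℚ ℝ A
  have hX1 : IsStrictlyPositive (NormedSpace.exp X) :=
    ⟨hX.exp_nonneg, NormedSpace.isUnit_exp X⟩
  have hY1 : IsStrictlyPositive (NormedSpace.exp Y) :=
    ⟨hY.exp_nonneg, NormedSpace.isUnit_exp Y⟩
  have := CFC.log_le_log h hX1
  rw [CFC.log_exp X hX, CFC.log_smul' _ hc hY1, CFC.log_exp Y hY] at this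
  rwa [add_comm]

lemma aux_norm_le {X : A} {r : ℝ} (hr : 0 ≤ r) (h1 : X ≤ algebraMap ℝ A r)
    (h2 : 0 ≤ X + algebraMap ℝ A r) : ‖X‖ ≤ 3 * r := by
  have h3 : ‖X + algebraMap ℝ A r‖ ≤ 2 * r := by
    rw [CStarAlgebra.norm_le_iff_le_algebraMap _ (by positivity) h2, two_mul, map_add]
    gcongr
  have h4 : ‖algebraMap ℝ A r‖ ≤ r := by
    have h0 : (0 : A) ≤ algebraMap ℝ A r := by simpa using algebraMap_mono A hr
    rw [CStarAlgebra.norm_le_iff_le_algebraMap _ hr h0]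
  calc ‖X‖ = ‖(X + algebraMap ℝ A r) - algebraMap ℝ A r‖ := by simp
    _ ≤ _ := norm_sub_le _ _
    _ ≤ _ := by linarith

lemma aux_conj_le {E F B : A} (hE : E = F * B) {c : ℝ} (hc : ‖B‖ ≤ c) :
    E * star E ≤ (c ^ 2) • (F * star F) := by
  have h1 : B * star B ≤ algebraMap ℝ A (c ^ 2) := by
    refine CStarAlgebra.mul_star_le_algebraMap_norm_sq.trans ?_
    exact algebraMap_mono A (by gcongr)
  have := star_right_conjugate_le_conjugate h1 F
  rw [hE, star_mul]
  calc _ = F * (B * star B) * star F := by simp only [mul_assoc]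
    _ ≤ _ := this
    _ = _ := by simp [Algebra.algebraMap_eq_smul_one]

lemma aux_norm_log {E F B B' S H : A} (hB : E = F * B) (hB' : F = E * B') {c : ℝ} (hc : 1 ≤ c)
    (h1 : ‖B‖ ≤ c) (h2 : ‖B'‖ ≤ c) (hS : IsSelfAdjoint S) (hH : IsSelfAdjoint H)
    (hSE : NormedSpace.exp S = E * star E) (hHF : NormedSpace.exp H = F * star F) :
    ‖S - H‖ ≤ 6 * Real.log c := by
  have hc2 : 0 < c ^ 2 := by positivity
  have e1 := aux_conj_le hB h1
  have e2 := aux_conj_le hB' h2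
  rw [← hSE, ← hHF] at e1 e2
  have g1 := aux_le_of_exp_le hS hH hc2 e1
  have g2 := aux_le_of_exp_le hH hS hc2 e2
  have hl : Real.log (c ^ 2) = 2 * Real.log c := by simp
  have := aux_norm_le (X := S - H) (r := Real.log (c ^ 2))
    (by rw [hl]; have := Real.log_nonneg hc; positivity)
    (by rw [sub_le_iff_le_add, add_comm]; exact g1)
    (by rw [sub_add_eq_add_sub, sub_nonneg]; exact g2)
  rw [hl] at this
  linarith

lemma aux_gronwall {f f' : ℝ → A} {ε : ℝ} (hf : ∀ t, HasDerivAt f (f' t) t)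
    (hb : ∀ t, 0 ≤ t → ‖f' t‖ ≤ ε * ‖f t‖) (t : ℝ) (ht : 0 ≤ t) :
    ‖f t‖ ≤ ‖f 0‖ * Real.exp (ε * t) := by
  have := norm_le_gronwallBound_of_norm_deriv_right_le (f := f) (f' := f') (δ := ‖f 0‖) (K := ε)
    (ε := 0) (a := 0) (b := t)
    (fun x _ => (hf x).continuousAt.continuousWithinAt) (fun x _ => (hf x).hasDerivWithinAt)
    le_rfl (fun x hx => by simpa using hb x hx.1) t ⟨ht, le_rfl⟩
  simpa [gronwallBound_ε0] using this

lemma aux_exp_neg_mul (t : ℝ) (X : A) :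
    NormedSpace.exp (t • X) * NormedSpace.exp (t • (-X)) = 1 := by
  let _ : NormedAlgebra ℚ A := NormedAlgebra.restrictScalars ℚ ℝ A
  rw [← NormedSpace.exp_add_of_commute]
  · simp
  · exact ((Commute.refl X).neg_right.smul_left t).smul_right t

lemma aux_exp_neg_mul' (t : ℝ) (X : A) :
    NormedSpace.exp (t • (-X)) * NormedSpace.exp (t • X) = 1 := by
  simpa using aux_exp_neg_mul t (-X)

lemma aux_growth {D N : A} {ε : ℝ}
    (h : ∀ t : ℝ, 0 ≤ t → ‖NormedSpace.exp (t • (-D)) * N * NormedSpace.exp (t • D)‖ ≤ ε)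
    (t : ℝ) (ht : 0 ≤ t) :
    ‖NormedSpace.exp (t • (-D)) * NormedSpace.exp (t • (D + N))‖ ≤ ‖(1 : A)‖ * Real.exp (ε * t) ∧
    ‖NormedSpace.exp (t • (-(D + N))) * NormedSpace.exp (t • D)‖ ≤ ‖(1 : A)‖ * Real.exp (ε * t) := by
  constructor
  · have := aux_gronwall (A := A)
      (f := fun t => NormedSpace.exp (t • (-D)) * NormedSpace.exp (t • (D + N)))
      (f' := fun t => (NormedSpace.exp (t • (-D)) * N * NormedSpace.exp (t • D)) *
        (NormedSpace.exp (t • (-D)) * NormedSpace.exp (t • (D + N)))) (ε := ε) ?_ ?_ t ht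
    · simpa using this
    · intro t
      refine ((hasDerivAt_exp_smul_const (-D) t).mul (hasDerivAt_exp_smul_const' (D + N) t)).congr_deriv ?_
      rw [mul_assoc (_ * N), ← mul_assoc (NormedSpace.exp (t • D)), aux_exp_neg_mul]
      noncomm_ring
    · intro t ht
      exact (norm_mul_le _ _).trans (by gcongr; exact h t ht)
  · have := aux_gronwall (A := A)
      (f := fun t => NormedSpace.exp (t • (-(D + N))) * NormedSpace.exp (t • D))
      (f' := fun t => -((NormedSpace.exp (t • (-(D + N))) * NormedSpace.exp (t • D)) *
        (NormedSpace.exp (t • (-D)) * N * NormedSpace.exp (t • D)))) (ε := ε) ?_ ?_ t ht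
    · simpa using this
    · intro t
      refine ((hasDerivAt_exp_smul_const (-(D + N)) t).mul (hasDerivAt_exp_smul_const' D t)).congr_deriv ?_
      rw [mul_assoc _ N, mul_assoc _ (NormedSpace.exp (t • D)),
        ← mul_assoc (NormedSpace.exp (t • D)), aux_exp_neg_mul]
      noncomm_ring
    · intro t ht
      rw [norm_neg, mul_comm]
      exact (norm_mul_le _ _).trans (by gcongr; exact h t ht)

/-- growth comparison of `exp (tK)` and `exp (tD)`. -/
def AuxComparable (K D : A) : Prop :=
  ∀ ε : ℝ, 0 < ε → ∃ C : ℝ, ∀ t : ℝ, 0 ≤ t →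
    ‖NormedSpace.exp (t • (-D)) * NormedSpace.exp (t • K)‖ ≤ C * Real.exp (ε * t) ∧
    ‖NormedSpace.exp (t • (-K)) * NormedSpace.exp (t • D)‖ ≤ C * Real.exp (ε * t)

lemma aux_tendsto {K D : A} (h : AuxComparable K D) (hD : Commute D (star D)) {S : ℝ → A}
    (hS : ∀ t : ℝ, 0 < t → IsSelfAdjoint (S t) ∧
      NormedSpace.exp (S t) = NormedSpace.exp (t • K) * star (NormedSpace.exp (t • K))) :
    Filter.Tendsto (fun t : ℝ => (1 / (2 * t)) • S t) Filter.atTop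
      (nhds ((1 / 2 : ℝ) • (D + star D))) := by
  let _ : NormedAlgebra ℚ A := NormedAlgebra.restrictScalars ℚ ℝ A
  rw [Metric.tendsto_atTop]
  intro ε hε
  obtain ⟨C, hC⟩ := h (ε / 6) (by positivity)
  set C' := max C 1 with hC'
  have hC1 : 1 ≤ C' := le_max_right _ _
  have hlC : 0 ≤ Real.log C' := Real.log_nonneg hC1
  refine ⟨(6 * Real.log C' + 1) / ε + 1, fun t ht => ?_⟩
  have ht0 : 0 < t := by
    have : 0 ≤ (6 * Real.log C' + 1) / ε := by positivity
    linarith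
  obtain ⟨hs1, hs2⟩ := hS t ht0
  obtain ⟨b1, b2⟩ := hC t ht0.le
  have hcc : C * Real.exp (ε / 6 * t) ≤ C' * Real.exp (ε / 6 * t) := by
    gcongr; exact le_max_left _ _
  have hH : IsSelfAdjoint (t • (D + star D)) := by
    rw [isSelfAdjoint_iff]; simp [add_comm]
  have key := aux_norm_log (A := A) (E := NormedSpace.exp (t • K)) (F := NormedSpace.exp (t • D))
    (B := NormedSpace.exp (t • (-D)) * NormedSpace.exp (t • K))
    (B' := NormedSpace.exp (t • (-K)) * NormedSpace.exp (t • D))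
    (S := S t) (H := t • (D + star D)) (c := C' * Real.exp (ε / 6 * t))
    (by rw [← mul_assoc, aux_exp_neg_mul, one_mul])
    (by rw [← mul_assoc, aux_exp_neg_mul, one_mul])
    (by
      have : 1 ≤ Real.exp (ε / 6 * t) := Real.one_le_exp (by positivity)
      nlinarith)
    (b1.trans hcc) (b2.trans hcc) hs1 hH hs2
    (by
      rw [smul_add, NormedSpace.exp_add_of_commute ((hD.smul_left t).smul_right t),
        NormedSpace.star_exp]
      simp)
  rw [Real.log_mul (by positivity) (by positivity), Real.log_exp] at key
  rw [dist_eq_norm]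
  have e : (1 / (2 * t)) • S t - (1 / 2 : ℝ) • (D + star D)
      = (1 / (2 * t)) • (S t - t • (D + star D)) := by
    rw [smul_sub, smul_smul]; congr 2; field_simp
  rw [e, norm_smul, Real.norm_of_nonneg (by positivity)]
  have h6 : 6 * Real.log C' + 1 ≤ t * ε := by
    have : (6 * Real.log C' + 1) / ε ≤ t := by linarith
    rwa [div_le_iff₀ hε] at this
  rw [div_mul_eq_mul_div, one_mul, div_lt_iff₀ (by positivity)]
  nlinarith

end Abstract

/-- First step of the Schur decomposition: a unitary matrix with prescribed first column. -/
lemma aux_unitary_first_col {n : ℕ} (v : EuclideanSpace ℂ (Fin (n + 1))) (hv : ‖v‖ = 1) :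
    ∃ U ∈ unitaryGroup (Fin (n + 1)) ℂ, ∀ i, U i 0 = v i := by
  obtain ⟨b, hb⟩ := Orthonormal.exists_orthonormalBasis_extension_of_card_eq (𝕜 := ℂ)
    (E := EuclideanSpace ℂ (Fin (n + 1))) (ι := Fin (n + 1)) (by simp) (v := fun _ => v)
    (s := {0}) (by
      constructor
      · intro i; simpa using hv
      · intro i j hij
        exact absurd (Subsingleton.elim i j) hij)
  refine ⟨Matrix.of fun i j => b j i, ?_, fun i => by simp [hb 0 rfl]⟩
  rw [mem_unitaryGroup_iff']
  ext i j
  have := orthonormal_iff_ite.mp b.orthonormal i j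
  rw [PiLp.inner_apply] at this
  rw [star_eq_conjTranspose, mul_apply, one_apply, ← this]
  refine Finset.sum_congr rfl fun k _ => ?_
  simp [mul_comm]

lemma aux_exists_eigen {n : ℕ} (K : Matrix (Fin (n + 1)) (Fin (n + 1)) ℂ) :
    ∃ μ : ℂ, (∀ ν ∈ K.charpoly.roots, ν.re ≤ μ.re) ∧
      ∃ v : EuclideanSpace ℂ (Fin (n + 1)), ‖v‖ = 1 ∧ K *ᵥ v.ofLp = μ • v.ofLp := by
  have hne : K.charpoly.roots.toFinset.Nonempty := by
    obtain ⟨z, hz⟩ := IsAlgClosed.exists_root K.charpoly (by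
      rw [charpoly_degree_eq_dim]; simp; exact_mod_cast Nat.succ_ne_zero n)
    exact ⟨z, by simpa [K.charpoly_monic.ne_zero] using hz⟩
  obtain ⟨μ, hμ, hmax⟩ := Finset.exists_max_image _ Complex.re hne
  refine ⟨μ, fun ν hν => hmax ν (by simpa using hν), ?_⟩
  have hdet : (scalar (Fin (n + 1)) μ - K).det = 0 := by
    rw [← eval_charpoly]
    have := (Polynomial.mem_roots K.charpoly_monic.ne_zero).mp (Multiset.mem_toFinset.mp hμ)
    exact this
  obtain ⟨w, hw0, hw⟩ := Matrix.exists_mulVec_eq_zero_iff.mpr hdet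
  have hKw : K *ᵥ w = μ • w := by
    rw [sub_mulVec, sub_eq_zero] at hw
    rw [← hw]; ext i; simp [scalar_apply, mulVec_diagonal]
  have hw1 : WithLp.toLp 2 w ≠ 0 := by simpa using hw0
  refine ⟨((‖WithLp.toLp 2 w‖⁻¹ : ℝ) : ℂ) • WithLp.toLp 2 w, ?_, ?_⟩
  · rw [norm_smul]
    simp [hw1]
  · rw [WithLp.ofLp_smul, mulVec_smul, hKw, smul_comm]

lemma aux_charpoly_conj {n : ℕ} {U K : Matrix (Fin n) (Fin n) ℂ}
    (hU : U ∈ unitaryGroup (Fin n) ℂ) : (star U * K * U).charpoly = K.charpoly := by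
  rw [charpoly_mul_comm, ← mul_assoc, mem_unitaryGroup_iff.mp hU, one_mul]

/-- Schur decomposition with diagonal ordered by decreasing real parts. -/
lemma aux_schur : ∀ (n : ℕ) (K : Matrix (Fin n) (Fin n) ℂ), ∃ U ∈ unitaryGroup (Fin n) ℂ,
    (∀ i j, j < i → (star U * K * U) i j = 0) ∧
    ∀ i j, i < j → ((star U * K * U) j j).re ≤ ((star U * K * U) i i).re := by
  intro n
  induction n with
  | zero => intro K; exact ⟨1, one_mem _, fun i => i.elim0, fun i => i.elim0⟩
  | succ n ih =>
    intro K
    obtain ⟨μ, hmax, v, hv, hKv⟩ := aux_exists_eigen K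
    obtain ⟨U, hU, hUv⟩ := aux_unitary_first_col v hv
    have hUU := mem_unitaryGroup_iff'.mp hU
    set M := star U * K * U with hM
    have hM0 : ∀ i, M i 0 = if i = 0 then μ else 0 := by
      intro i
      have h1 : U.col 0 = v.ofLp := by ext i; exact hUv i
      have h2 : M.col 0 = μ • (1 : Matrix (Fin (n+1)) (Fin (n+1)) ℂ).col 0 := by
        rw [← mulVec_single_one, ← mulVec_single_one, hM, ← mulVec_mulVec, ← mulVec_mulVec,
          mulVec_single_one, h1, hKv, ← h1, ← mulVec_single_one, mulVec_smul, mulVec_mulVec, hUU]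
      have := congrFun h2 i
      simpa [Matrix.col_apply, one_apply] using this
    obtain ⟨U', hU', htri, hord⟩ := ih (M.submatrix Fin.succ Fin.succ)
    set V : Matrix (Fin (n+1)) (Fin (n+1)) ℂ :=
      Matrix.of (Fin.cons (Fin.cons 1 0) (fun i => Fin.cons 0 (U' i))) with hV
    have V00 : V 0 0 = 1 := rfl
    have V0s : ∀ j : Fin n, V 0 j.succ = 0 := fun j => rfl
    have Vs0 : ∀ j : Fin n, V j.succ 0 = 0 := fun j => rfl
    have Vss : ∀ i j : Fin n, V i.succ j.succ = U' i j := fun i j => rfl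
    have hVu : V ∈ unitaryGroup (Fin (n+1)) ℂ := by
      have hUU' := mem_unitaryGroup_iff'.mp hU'
      rw [mem_unitaryGroup_iff']
      ext i j
      have h := fun i j => congrFun (congrFun hUU' i) j
      simp only [mul_apply, star_apply, one_apply] at h
      refine Fin.cases ?_ (fun i => ?_) i <;> refine Fin.cases ?_ (fun j => ?_) j <;>
        simp [mul_apply, Fin.sum_univ_succ, V00, V0s, Vs0, Vss, one_apply, (Fin.succ_ne_zero _).symm]
      simpa using h i j
    have hT00 : (star V * M * V) 0 0 = μ := by
      simp [mul_apply, Fin.sum_univ_succ, V00, V0s, Vs0, Vss, hM0]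
    have hTs0 : ∀ i : Fin n, (star V * M * V) i.succ 0 = 0 := by
      intro i
      simp [mul_apply, Fin.sum_univ_succ, V00, V0s, Vs0, Vss, hM0]
    have hTss : ∀ i j : Fin n, (star V * M * V) i.succ j.succ =
        (star U' * M.submatrix Fin.succ Fin.succ * U') i j := by
      intro i j
      simp [mul_apply, Fin.sum_univ_succ, V00, V0s, Vs0, Vss, hM0]
    have hUV : star (U * V) * K * (U * V) = star V * M * V := by
      rw [star_mul, hM]; simp only [mul_assoc]
    have hUVu := mul_mem hU hVu
    have htri' : ∀ i j, j < i → (star V * M * V) i j = 0 := by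
      intro i j
      refine Fin.cases ?_ (fun i => ?_) i <;> refine Fin.cases ?_ (fun j => ?_) j
      · simp
      · simp
      · intro _; exact hTs0 i
      · intro hij; rw [hTss]; exact htri i j (by simpa using hij)
    refine ⟨U * V, hUVu, by rwa [hUV], ?_⟩
    have hcp : (star V * M * V).charpoly = K.charpoly := by
      rw [← hUV]; exact aux_charpoly_conj hUVu
    have hcp2 := charpoly_of_isUpperTriangular (star V * M * V) (fun i j hij => htri' i j hij)
    have hroot : ∀ i, (star V * M * V) i i ∈ K.charpoly.roots := by
      intro i
      rw [← hcp, hcp2, Polynomial.mem_roots (by rw [← hcp2]; exact (charpoly_monic _).ne_zero),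
        Polynomial.IsRoot.def, Polynomial.eval_prod]
      exact Finset.prod_eq_zero (Finset.mem_univ i) (by simp)
    rw [hUV]
    intro i j
    refine Fin.cases ?_ (fun i => ?_) i <;> refine Fin.cases ?_ (fun j => ?_) j
    · simp
    · intro _; rw [hT00]; exact hmax _ (hroot _)
    · simp
    · intro hij; rw [hTss, hTss]; exact hord i j (by simpa using hij)

section Abstract2

variable {A : Type*} [CStarAlgebra A] [PartialOrder A] [StarOrderedRing A]

lemma aux_comparable {K D D₀ : A}
    (h : ∀ ε : ℝ, 0 < ε → ∃ (G : Aˣ) (N : A), K * G = G * (D₀ + N) ∧ D * G = G * D₀ ∧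
      ∀ t : ℝ, 0 ≤ t → ‖NormedSpace.exp (t • (-D₀)) * N * NormedSpace.exp (t • D₀)‖ ≤ ε) :
    AuxComparable K D := by
  let _ : NormedAlgebra ℚ A := NormedAlgebra.restrictScalars ℚ ℝ A
  intro ε hε
  obtain ⟨G, N, hK, hD, hN⟩ := h ε hε
  have key : ∀ X Y : A, X * G = G * Y → ∀ t : ℝ,
      NormedSpace.exp (t • X) = G * NormedSpace.exp (t • Y) * ((G⁻¹ : Aˣ) : A) := by
    intro X Y hXY t
    rw [← NormedSpace.exp_units_conj]
    congr 1
    rw [mul_smul_comm, ← hXY, smul_mul_assoc, mul_assoc, Units.mul_inv, mul_one]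
  have keyK := key K _ hK
  have keyD := key D _ hD
  have keyK' := key (-K) (-(D₀ + N)) (by rw [neg_mul, hK, mul_neg])
  have keyD' := key (-D) (-D₀) (by rw [neg_mul, hD, mul_neg])
  have comb : ∀ X Y : A, (G * X * ((G⁻¹ : Aˣ) : A)) * (G * Y * ((G⁻¹ : Aˣ) : A))
      = G * (X * Y) * ((G⁻¹ : Aˣ) : A) := by
    intro X Y
    simp only [mul_assoc, Units.inv_mul_cancel_left]
  have bd : ∀ X : A, ‖G * X * ((G⁻¹ : Aˣ) : A)‖ ≤ ‖(G : A)‖ * ‖X‖ * ‖((G⁻¹ : Aˣ) : A)‖ := by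
    intro X
    exact (norm_mul_le _ _).trans (by gcongr; exact norm_mul_le _ _)
  refine ⟨‖(G : A)‖ * ‖(1 : A)‖ * ‖((G⁻¹ : Aˣ) : A)‖, fun t ht => ?_⟩
  obtain ⟨g1, g2⟩ := aux_growth hN t ht
  constructor
  · rw [keyD', keyK, comb]
    refine (bd _).trans ?_
    calc _ ≤ ‖(G : A)‖ * (‖(1 : A)‖ * Real.exp (ε * t)) * ‖((G⁻¹ : Aˣ) : A)‖ := by gcongr
      _ = _ := by ring
  · rw [keyD, keyK', comb]
    refine (bd _).trans ?_
    calc _ ≤ ‖(G : A)‖ * (‖(1 : A)‖ * Real.exp (ε * t)) * ‖((G⁻¹ : Aˣ) : A)‖ := by gcongr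
      _ = _ := by ring

end Abstract2

section MatrixPart

open scoped Matrix.Norms.L2Operator MatrixOrder

lemma aux_norm_entries (n : ℕ) : ∃ C : ℝ, 0 < C ∧ ∀ (M : Matrix (Fin n) (Fin n) ℂ) (r : ℝ),
    0 ≤ r → (∀ i j, ‖M i j‖ ≤ r) → ‖M‖ ≤ C * r := by
  refine ⟨(∑ i : Fin n, ∑ j : Fin n, ‖(single i j 1 : Matrix (Fin n) (Fin n) ℂ)‖) + 1,
    by positivity, fun M r hr h => ?_⟩
  calc ‖M‖ = ‖∑ i, ∑ j, (M i j) • (single i j 1 : Matrix (Fin n) (Fin n) ℂ)‖ := by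
        congr 1
        conv_lhs => rw [matrix_eq_sum_single M]
        simp
    _ ≤ ∑ i, ∑ j, r * ‖(single i j 1 : Matrix (Fin n) (Fin n) ℂ)‖ := by
        refine (norm_sum_le _ _).trans (Finset.sum_le_sum fun i _ => ?_)
        refine (norm_sum_le _ _).trans (Finset.sum_le_sum fun j _ => ?_)
        rw [norm_smul]
        gcongr
        exact h i j
    _ ≤ _ := by
        simp only [← Finset.mul_sum]
        nlinarith

lemma aux_schur_comparable {n : ℕ} {K U T : Matrix (Fin n) (Fin n) ℂ}
    (hU : U ∈ unitaryGroup (Fin n) ℂ) (hT : star U * K * U = T)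
    (htri : ∀ i j, j < i → T i j = 0) (hord : ∀ i j, i < j → (T j j).re ≤ (T i i).re) :
    AuxComparable K (U * diagonal (fun i => T i i) * star U) := by
  have h1 := mem_unitaryGroup_iff'.mp hU
  have h2 := mem_unitaryGroup_iff.mp hU
  apply aux_comparable (D₀ := diagonal (fun i => T i i))
  intro ε hε
  obtain ⟨C, hC, hCM⟩ := aux_norm_entries n
  obtain ⟨m, hm0, hm⟩ : ∃ m : ℝ, 0 < m ∧ ∀ i j, ‖T i j‖ ≤ m := by
    refine ⟨(∑ i, ∑ j, ‖T i j‖) + 1, by positivity, fun i j => ?_⟩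
    have a := Finset.single_le_sum (f := fun j => ‖T i j‖) (fun _ _ => norm_nonneg _)
      (Finset.mem_univ j)
    have b := Finset.single_le_sum (f := fun i => ∑ j, ‖T i j‖)
      (fun _ _ => Finset.sum_nonneg fun _ _ => norm_nonneg _) (Finset.mem_univ i)
    change _ ≤ ∑ i, ∑ j, ‖T i j‖ at b
    change ‖T i j‖ ≤ _ at a
    linarith
  set δ : ℝ := min 1 (ε / (C * m)) with hδ
  have hδ0 : 0 < δ := lt_min one_pos (by positivity)
  have hδ1 : δ ≤ 1 := min_le_left _ _
  have hδε : C * (δ * m) ≤ ε := by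
    have : δ ≤ ε / (C * m) := min_le_right _ _
    rw [le_div_iff₀ (by positivity)] at this
    linarith
  have hδc : (δ : ℂ) ≠ 0 := by exact_mod_cast hδ0.ne'
  let W : Matrix (Fin n) (Fin n) ℂ := diagonal fun i => (δ : ℂ) ^ (i : ℕ)
  let W' : Matrix (Fin n) (Fin n) ℂ := diagonal fun i => ((δ : ℂ) ^ (i : ℕ))⁻¹
  have hWW' : W * W' = 1 := by
    simp [W, W', diagonal_mul_diagonal, hδc]
  have hW'W : W' * W = 1 := by
    simp [W, W', diagonal_mul_diagonal, hδc]
  let N : Matrix (Fin n) (Fin n) ℂ :=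
    Matrix.of fun i j => if i < j then (δ : ℂ) ^ ((j : ℕ) - (i : ℕ)) * T i j else 0
  have hTW : T * W = W * (diagonal (fun i => T i i) + N) := by
    ext i j
    rw [mul_diagonal, diagonal_mul, Matrix.add_apply, diagonal_apply]
    simp only [N, of_apply]
    rcases lt_trichotomy i j with h | h | h
    · rw [if_neg h.ne, if_pos h, zero_add, ← mul_assoc, ← pow_add,
        Nat.add_sub_cancel' (le_of_lt (Fin.lt_def.mp h)), mul_comm]
    · subst h; simp [mul_comm]
    · rw [if_neg h.ne', if_neg h.le.not_gt, htri i j h]; simp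
  refine ⟨⟨U * W, W' * star U, ?_, ?_⟩, N, ?_, ?_, ?_⟩
  · rw [mul_assoc, ← mul_assoc W, hWW', one_mul, h2]
  · rw [mul_assoc, ← mul_assoc (star U), h1, one_mul, hW'W]
  · change K * (U * W) = U * W * _
    rw [mul_assoc U, ← hTW, ← hT]
    simp only [← mul_assoc]
    rw [h2, one_mul]
  · change _ * (U * W) = U * W * _
    have : diagonal (fun i => T i i) * W = W * diagonal (fun i => T i i) := by
      simp [W, diagonal_mul_diagonal, mul_comm]
    rw [mul_assoc U W, ← this]
    simp only [mul_assoc]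
    rw [← mul_assoc (star U), h1, one_mul]
  · intro t ht
    refine (hCM _ (δ * m) (by positivity) ?_).trans hδε
    intro i j
    have e1 : t • (-diagonal (fun i => T i i)) = diagonal (fun i => -(t * T i i)) := by
      ext i j; by_cases h : i = j <;> simp [h]
    have e2 : t • (diagonal (fun i => T i i)) = diagonal (fun i => (t * T i i)) := by
      ext i j; by_cases h : i = j <;> simp [h]
    rw [e1, e2, Matrix.exp_diagonal, Matrix.exp_diagonal, mul_diagonal, diagonal_mul,
      Pi.coe_exp, Pi.coe_exp, ← Complex.exp_eq_exp_ℂ]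
    simp only [N, of_apply]
    split_ifs with h
    · rw [norm_mul, norm_mul, Complex.norm_exp, Complex.norm_exp, norm_mul, norm_pow,
        Complex.norm_real, Real.norm_of_nonneg hδ0.le]
      have hp : δ ^ ((j : ℕ) - (i : ℕ)) ≤ δ := by
        have : (j : ℕ) - (i : ℕ) ≠ 0 := by have := Fin.lt_def.mp h; omega
        exact pow_le_of_le_one hδ0.le hδ1 this
      have he : Real.exp (-(t * T i i)).re * Real.exp (t * T j j).re ≤ 1 := by
        rw [← Real.exp_add, Real.exp_le_one_iff]
        have := hord i j h
        simp
        nlinarith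
      calc _ = (Real.exp (-(t * T i i)).re * Real.exp (t * T j j).re) *
            (δ ^ ((j : ℕ) - (i : ℕ)) * ‖T i j‖) := by ring
        _ ≤ 1 * (δ * m) := by gcongr; exact hm i j
        _ = _ := one_mul _
    · simp; positivity

lemma aux_exists_log {n : ℕ} (E : Matrix (Fin n) (Fin n) ℝ) (hE : IsUnit E) :
    ∃ S : Matrix (Fin n) (Fin n) ℝ, Sᵀ = S ∧ NormedSpace.exp S = E * Eᵀ := by
  have hpos : IsStrictlyPositive (E * Eᵀ) := by
    refine ⟨?_, hE.mul ?_⟩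
    · have := mul_star_self_nonneg E
      rwa [star_eq_conjTranspose, conjTranspose_eq_transpose_of_trivial] at this
    · rwa [isUnit_transpose]
  refine ⟨CFC.log (E * Eᵀ), ?_, CFC.exp_log _ hpos⟩
  have : IsSelfAdjoint (CFC.log (E * Eᵀ)) := IsSelfAdjoint.log
  rw [isSelfAdjoint_iff, star_eq_conjTranspose, conjTranspose_eq_transpose_of_trivial] at this
  exact this

lemma aux_roots {n : ℕ} {R : Type*} [CommRing R] [IsDomain R] (f : Fin n → R) :
    (∏ i, (Polynomial.X - Polynomial.C (f i))).roots = Finset.univ.val.map f := by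
  have := Polynomial.roots_multiset_prod_X_sub_C (Finset.univ.val.map f)
  rwa [Multiset.map_map] at this

lemma aux_map_exp {n : ℕ} (X : Matrix (Fin n) (Fin n) ℝ) :
    (NormedSpace.exp X).map (algebraMap ℝ ℂ) = NormedSpace.exp (X.map (algebraMap ℝ ℂ)) := by
  let _ : NormedAlgebra ℚ (Matrix (Fin n) (Fin n) ℝ) := NormedAlgebra.restrictScalars ℚ ℝ _
  let _ : NormedAlgebra ℚ (Matrix (Fin n) (Fin n) ℂ) := NormedAlgebra.restrictScalars ℚ ℝ _
  exact NormedSpace.map_exp ((algebraMap ℝ ℂ).mapMatrix (m := Fin n))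
    (Continuous.matrix_map continuous_id (continuous_algebraMap ℝ ℂ)) X

theorem aux_main (n : ℕ)
    (K : Matrix (Fin n) (Fin n) ℝ) :
    ∃ L : Matrix (Fin n) (Fin n) ℝ, Lᵀ = L ∧
      (∃ S : ℝ → Matrix (Fin n) (Fin n) ℝ, ∀ t : ℝ, 0 < t →
        (S t)ᵀ = S t ∧
        NormedSpace.exp (S t) =
          NormedSpace.exp (t • K) * (NormedSpace.exp (t • K))ᵀ) ∧
      (∀ S : ℝ → Matrix (Fin n) (Fin n) ℝ,
        (∀ t : ℝ, 0 < t →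
          (S t)ᵀ = S t ∧
          NormedSpace.exp (S t) =
            NormedSpace.exp (t • K) * (NormedSpace.exp (t • K))ᵀ) →
        Filter.Tendsto (fun t : ℝ => (1 / (2 * t)) • S t) Filter.atTop (nhds L)) ∧
      L.charpoly.roots = (K.charpoly.map (algebraMap ℝ ℂ)).roots.map Complex.re := by
  obtain ⟨U, hU, htri, hord⟩ := aux_schur n (K.map (algebraMap ℝ ℂ))
  set Kc := K.map (algebraMap ℝ ℂ) with hKc
  set T := star U * Kc * U with hT
  have h1 := mem_unitaryGroup_iff'.mp hU
  have h2 := mem_unitaryGroup_iff.mp hU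
  have hcomp := aux_schur_comparable hU hT.symm htri hord
  set D := U * diagonal (fun i => T i i) * star U with hD
  set Lc := (1 / 2 : ℝ) • (D + star D) with hLc
  have hstarD : star D = U * diagonal (fun i => star (T i i)) * star U := by
    rw [hD, star_mul, star_mul, star_star, star_eq_conjTranspose (diagonal _),
      diagonal_conjTranspose, mul_assoc]
    rfl
  have hLcU : Lc = U * diagonal (fun i => ((T i i).re : ℂ)) * star U := by
    rw [hLc, hstarD, hD, ← add_mul, ← mul_add, ← smul_mul_assoc, ← mul_smul_comm]
    congr 2
    ext i j
    by_cases h : i = j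
    · subst h
      apply Complex.ext <;> simp
      ring
    · simp [h]
  have hnormal : Commute D (star D) := by
    rw [hstarD, hD, Commute, SemiconjBy]
    have cc : ∀ X Y : Matrix (Fin n) (Fin n) ℂ, U * X * star U * (U * Y * star U)
        = U * (X * Y) * star U := by
      intro X Y
      simp only [mul_assoc]
      rw [← mul_assoc (star U) U, h1, one_mul]
    rw [cc, cc, diagonal_mul_diagonal, diagonal_mul_diagonal]
    simp only [mul_comm]
  have hconv : ∀ S : ℝ → Matrix (Fin n) (Fin n) ℝ,
        (∀ t : ℝ, 0 < t →
          (S t)ᵀ = S t ∧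
          NormedSpace.exp (S t) =
            NormedSpace.exp (t • K) * (NormedSpace.exp (t • K))ᵀ) →
        Filter.Tendsto (fun t : ℝ => ((1 / (2 * t)) • S t).map (algebraMap ℝ ℂ))
          Filter.atTop (nhds Lc) := by
    intro S hS
    have hsm : ∀ (t : ℝ) (X : Matrix (Fin n) (Fin n) ℝ),
        (t • X).map (algebraMap ℝ ℂ) = t • X.map (algebraMap ℝ ℂ) := by
      intro t X; ext i j; simp
    have hst : ∀ (X : Matrix (Fin n) (Fin n) ℝ),
        star (X.map (algebraMap ℝ ℂ)) = Xᵀ.map (algebraMap ℝ ℂ) := by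
      intro X; ext i j; simp
    have := aux_tendsto hcomp hnormal (S := fun t => (S t).map (algebraMap ℝ ℂ)) (by
      intro t ht
      obtain ⟨a, b⟩ := hS t ht
      constructor
      · rw [isSelfAdjoint_iff, hst, a]
      · rw [← aux_map_exp, b, Matrix.map_mul, ← hst, aux_map_exp, hsm])
    simpa only [hsm] using this
  have hex : ∃ S : ℝ → Matrix (Fin n) (Fin n) ℝ, ∀ t : ℝ, 0 < t →
        (S t)ᵀ = S t ∧
        NormedSpace.exp (S t) =
          NormedSpace.exp (t • K) * (NormedSpace.exp (t • K))ᵀ := by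
    choose S hS using fun t : ℝ =>
      aux_exists_log (NormedSpace.exp (t • K)) (Matrix.isUnit_exp _)
    exact ⟨S, fun t _ => hS t⟩
  have hreal : (Lc.map Complex.re).map (algebraMap ℝ ℂ) = Lc := by
    obtain ⟨S, hS⟩ := hex
    have hc := hconv S hS
    ext i j
    have him : (Lc i j).im = 0 := by
      have c1 : Filter.Tendsto (fun t : ℝ => ((((1 / (2 * t)) • S t).map (algebraMap ℝ ℂ)) i j).im)
          Filter.atTop (nhds (Lc i j).im) :=
        ((Complex.continuous_im.comp (continuous_id.matrix_elem i j)).tendsto Lc).comp hc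
      refine tendsto_nhds_unique c1 ?_
      simp
    apply Complex.ext
    · simp
    · simp [him]
  refine ⟨Lc.map Complex.re, ?_, hex, ?_, ?_⟩
  · have hs : star Lc = Lc := by
      rw [hLc]; simp [add_comm]
    ext i j
    have := congrArg Complex.re (congrFun (congrFun hs i) j)
    simpa using this
  · intro S hS
    have hc := ((Continuous.matrix_map continuous_id Complex.continuous_re).tendsto Lc).comp
      (hconv S hS)
    refine hc.congr fun t => ?_
    ext i j
    simp
  · have hL : (Lc.map Complex.re).charpoly =
        ∏ i, (Polynomial.X - Polynomial.C ((T i i).re)) := by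
      apply Polynomial.map_injective (algebraMap ℝ ℂ) (algebraMap ℝ ℂ).injective
      rw [← charpoly_map, hreal, hLcU, charpoly_mul_comm, ← mul_assoc, h1, one_mul,
        charpoly_diagonal, Polynomial.map_prod]
      simp
    have hK : K.charpoly.map (algebraMap ℝ ℂ) = ∏ i, (Polynomial.X - Polynomial.C (T i i)) := by
      rw [← charpoly_map, ← hKc, ← aux_charpoly_conj hU, ← hT]
      exact charpoly_of_isUpperTriangular T (fun i j hij => htri i j hij)
    rw [hL, hK, aux_roots, aux_roots, Multiset.map_map]
    rfl

end MatrixPart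

/-- For any real `n × n` matrix `K`, the limiting matrix
`L = lim_{t→∞} (1/(2t))·log(exp(tK)·exp(tK)ᵀ)` exists, where `log` of a positive definite
matrix is the unique real symmetric matrix whose matrix exponential equals it (here the
logarithm is represented by any function `S` with `S t` symmetric and
`exp (S t) = exp(tK)·exp(tK)ᵀ`).  Moreover the eigenvalues of `L`, with multiplicity,
are the real parts of the (complex) eigenvalues of `K`, with multiplicity. -/
theorem limiting_matrix_exists_of_time_independent (n : ℕ)
    (K : Matrix (Fin n) (Fin n) ℝ) :
    ∃ L : Matrix (Fin n) (Fin n) ℝ, Lᵀ = L ∧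
      (∃ S : ℝ → Matrix (Fin n) (Fin n) ℝ, ∀ t : ℝ, 0 < t →
        (S t)ᵀ = S t ∧
        NormedSpace.exp (S t) =
          NormedSpace.exp (t • K) * (NormedSpace.exp (t • K))ᵀ) ∧
      (∀ S : ℝ → Matrix (Fin n) (Fin n) ℝ,
        (∀ t : ℝ, 0 < t →
          (S t)ᵀ = S t ∧
          NormedSpace.exp (S t) =
            NormedSpace.exp (t • K) * (NormedSpace.exp (t • K))ᵀ) →
        Filter.Tendsto (fun t : ℝ => (1 / (2 * t)) • S t) Filter.atTop (nhds L)) ∧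
      L.charpoly.roots = (K.charpoly.map (algebraMap ℝ ℂ)).roots.map Complex.re := by
  exact aux_main n K
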